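/- Fix integers a < 0 and b ≥ 1 and a positive integer n, and suppose s is a positive integer with n = a·s + b·p_s. Then the iteration k_0 = π(⌊n/b⌋), k_{j+1} = π(⌊(n − a·k_j)/b⌋) satisfies k_j < s for all j ≥ 0; in particular, its eventual constant value k* (a fixed point of the map) satisfies k* < s, so the fixed point produced by the method is never a solution of n = a·k + b·p_k. -/

import Mathlib

/-- `p k` is the `k`-th prime number (`p 1 = 2`, `p 2 = 3`, ...). -/
noncomputable def p (k : ℕ) : ℕ := Nat.nth Nat.Prime (k - 1)

/-- The generalized iteration `k₀ = π(⌊n/b⌋)`, `k_{j+1} = π(⌊(n - a·k_j)/b⌋)`,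
with integer coefficients `a`, `b`. -/
noncomputable def kseqI (a b : ℤ) (n : ℕ) : ℕ → ℕ
  | 0 => Nat.primeCounting (((n : ℤ) / b).toNat)
  | j + 1 => Nat.primeCounting ((((n : ℤ) - a * kseqI a b n j) / b).toNat)

theorem primeCounting_lt_of_lt_p {s m : ℕ} (hs : 0 < s) (h : m < p s) :
    Nat.primeCounting m < s := by
  have h1 : Nat.primeCounting' (m + 1) ≤ Nat.primeCounting' (p s) :=
    Nat.monotone_primeCounting' h
  rw [p, Nat.primeCounting'_nth_eq] at h1
  rw [Nat.primeCounting_eq_primeCounting'_succ]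
  omega

theorem primeCounting_toNat_ediv_lt {a b : ℤ} (ha : a < 0) (hb : 1 ≤ b) {n s k : ℕ}
    (hsol : (n : ℤ) = a * s + b * p s) (hk : k < s) :
    Nat.primeCounting (((n : ℤ) - a * k) / b).toNat < s := by
  apply primeCounting_lt_of_lt_p (by omega)
  have hp : 0 < p s := (Nat.prime_nth_prime (s - 1)).pos
  have hlt : ((n : ℤ) - a * k) / b < p s := by
    apply Int.ediv_lt_of_lt_mul (by omega)
    have hk' : (k : ℤ) < s := by exact_mod_cast hk
    nlinarith
  omega

theorem kseqI_lt {a b : ℤ} (ha : a < 0) (hb : 1 ≤ b) {n s : ℕ} (hs : 0 < s)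
    (hsol : (n : ℤ) = a * s + b * p s) (j : ℕ) : kseqI a b n j < s := by
  induction j with
  | zero => simpa [kseqI] using primeCounting_toNat_ediv_lt ha hb hsol hs
  | succ j ih => exact primeCounting_toNat_ediv_lt ha hb hsol ih

theorem stmt_18 (a b : ℤ) (ha : a < 0) (hb : 1 ≤ b) (n : ℕ) (hn : 0 < n)
    (s : ℕ) (hs : 0 < s) (hsol : (n : ℤ) = a * s + b * p s) :
    (∀ j : ℕ, kseqI a b n j < s) ∧
    ∀ kstar J : ℕ, (∀ j, J ≤ j → kseqI a b n j = kstar) →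
      kstar < s ∧ (n : ℤ) ≠ a * kstar + b * p kstar := by
  refine ⟨kseqI_lt ha hb hs hsol, fun k J hJ => ⟨hJ J le_rfl ▸ kseqI_lt ha hb hs hsol J, ?_⟩⟩
  intro hk
  rcases Nat.eq_zero_or_pos k with rfl | hpos
  · have hfix := hJ (J + 1) (by omega)
    rw [kseqI, hJ J le_rfl, hk, Nat.primeCounting_eq_zero_iff] at hfix
    have hdiv : (a * ((0 : ℕ) : ℤ) + b * p 0 - a * ((0 : ℕ) : ℤ)) / b = p 0 := by
      rw [add_sub_cancel_left, Int.mul_ediv_cancel_left _ (by omega)]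
    have h2 : 2 ≤ p 0 := (Nat.prime_nth_prime _).two_le
    omega
  · exact (kseqI_lt ha hb hpos hk J).ne (hJ J le_rfl)
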